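/- Under the P-AGM-BiO iteration for the composite bilevel problem with arbitrary positive step sizes a_k > 0, for every k ≥ 0 it holds that A_{k+1}(g(x_{k+1}) − g(x*)) − A_k(g(x_k) − g(x*)) ≤ a_k (g_k − g(x*)) + ( L_g a_k² / (2 A_{k+1}) ) ‖z_{k+1} − z_k‖². -/

import Mathlib

open RealInnerProductSpace

section GradientBounds

variable {E : Type*} [NormedAddCommGroup E] [InnerProductSpace ℝ E] [CompleteSpace E]

theorem HasGradientAt.hasDerivAt_comp_lineMap {f : E → ℝ} {v x d : E} {t : ℝ}
    (h : HasGradientAt f v (x + t • d)) :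
    HasDerivAt (fun s : ℝ => f (x + s • d)) ⟪v, d⟫ t := by
  have hline : HasDerivAt (fun s : ℝ => x + s • d) d t := by
    simpa using ((hasDerivAt_id t).smul_const d).const_add x
  exact (h.hasFDerivAt.comp_hasDerivAt t hline).congr_deriv (by simp)

/-- The first-order lower bound for a convex function. -/
theorem ConvexOn.add_inner_gradient_le {f : E → ℝ} {v x : E}
    (hf : ConvexOn ℝ Set.univ f) (h : HasGradientAt f v x) (w : E) :
    f x + ⟪v, w - x⟫ ≤ f w := by
  have hd : HasDerivAt (fun s : ℝ => f (x + s • (w - x))) ⟪v, w - x⟫ 0 :=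
    HasGradientAt.hasDerivAt_comp_lineMap (by simpa using h)
  have hc : ConvexOn ℝ Set.univ (fun s : ℝ => f (x + s • (w - x))) := by
    refine ⟨convex_univ, fun s _ t _ p q hp hq hpq => ?_⟩
    have hcomb : x + (p • s + q • t) • (w - x)
        = p • (x + s • (w - x)) + q • (x + t • (w - x)) := by
      obtain rfl : p = 1 - q := by linarith
      module
    simpa only [hcomb] using hf.2 (Set.mem_univ _) (Set.mem_univ _) hp hq hpq
  have := hc.le_slope_of_hasDerivAt (Set.mem_univ 0) (Set.mem_univ 1) one_pos hd
  simp only [slope_def_field, one_smul, zero_smul, add_zero, sub_zero, div_one,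
    add_sub_cancel] at this
  linarith

/-- The descent lemma: the quadratic upper bound for a function with Lipschitz gradient. -/
theorem le_add_inner_gradient_add_sq {f : E → ℝ} {f' : E → E} {L : ℝ}
    (h : ∀ w, HasGradientAt f (f' w) w) (hL : ∀ u v, ‖f' u - f' v‖ ≤ L * ‖u - v‖) (x w : E) :
    f w ≤ f x + ⟪f' x, w - x⟫ + L / 2 * ‖w - x‖ ^ 2 := by
  set d := w - x with hd
  have hderiv (t : ℝ) : HasDerivAt
      (fun s : ℝ => f (x + s • d) - s * ⟪f' x, d⟫ - s ^ 2 * (L / 2 * ‖d‖ ^ 2))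
      (⟪f' (x + t • d), d⟫ - ⟪f' x, d⟫ - 2 * t * (L / 2 * ‖d‖ ^ 2)) t := by
    have h₁ := (h (x + t • d)).hasDerivAt_comp_lineMap
    have h₂ := (hasDerivAt_id t).mul_const ⟪f' x, d⟫
    have h₃ := (hasDerivAt_pow 2 t).mul_const (L / 2 * ‖d‖ ^ 2)
    exact ((h₁.sub h₂).sub h₃).congr_deriv (by simp)
  have hanti := antitoneOn_of_deriv_nonpos (convex_Icc (0 : ℝ) 1)
    (fun t _ => (hderiv t).continuousAt.continuousWithinAt)
    (fun t _ => (hderiv t).differentiableAt.differentiableWithinAt) (fun t ht => by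
      rw [interior_Icc] at ht
      rw [(hderiv t).deriv, ← inner_sub_left]
      have hlip := hL (x + t • d) x
      rw [add_sub_cancel_left, norm_smul, Real.norm_of_nonneg ht.1.le] at hlip
      have hcs := real_inner_le_norm (f' (x + t • d) - f' x) d
      have hmul := mul_le_mul_of_nonneg_right hlip (norm_nonneg d)
      linarith)
  have hle := hanti (Set.left_mem_Icc.2 zero_le_one) (Set.right_mem_Icc.2 zero_le_one) zero_le_one
  have hw : x + d = w := by rw [hd]; abel
  simp only [one_smul, zero_smul, add_zero, hw] at hle
  linarith

end GradientBounds

theorem pagm_bio_potential_g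
    {n : ℕ} {f₁ f₂ g₁ g₂ : EuclideanSpace ℝ (Fin n) → ℝ}
    {f₁' g₁' : EuclideanSpace ℝ (Fin n) → EuclideanSpace ℝ (Fin n)}
    {L_f L_g : ℝ} (hLf : 0 < L_f) (hLg : 0 < L_g)
    (hf₁conv : ConvexOn ℝ Set.univ f₁) (hf₂conv : ConvexOn ℝ Set.univ f₂)
    (hg₁conv : ConvexOn ℝ Set.univ g₁) (hg₂conv : ConvexOn ℝ Set.univ g₂)
    (hf₁' : ∀ w, HasGradientAt f₁ (f₁' w) w)
    (hg₁' : ∀ w, HasGradientAt g₁ (g₁' w) w)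
    (hLipf : ∀ u v, ‖f₁' u - f₁' v‖ ≤ L_f * ‖u - v‖)
    (hLipg : ∀ u v, ‖g₁' u - g₁' v‖ ≤ L_g * ‖u - v‖)
    {xstar : EuclideanSpace ℝ (Fin n)}
    (hxlow : ∀ w, g₁ xstar + g₂ xstar ≤ g₁ w + g₂ w)
    (hxopt : ∀ w, (∀ u, g₁ w + g₂ w ≤ g₁ u + g₂ u) → f₁ xstar + f₂ xstar ≤ f₁ w + f₂ w)
    {x z y : ℕ → EuclideanSpace ℝ (Fin n)} {A a gs : ℕ → ℝ}
    (hA0 : A 0 = 0) (hxz0 : x 0 = z 0)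
    (ha : ∀ k, 0 < a k)
    (hArec : ∀ k, A (k + 1) = A k + a k)
    (hy : ∀ k, y k = (A k / (A k + a k)) • x k + (a k / (A k + a k)) • z k)
    (hgs : ∀ k, g₁ xstar + g₂ xstar ≤ gs k)
    (hzmem : ∀ k, g₁ (y k) + ⟪g₁' (y k), z (k + 1) - y k⟫ + g₂ (z (k + 1)) ≤ gs k)
    (hzprox : ∀ k, ∀ u, g₁ (y k) + ⟪g₁' (y k), u - y k⟫ + g₂ u ≤ gs k →
        1 / (2 * a k) * ‖z (k + 1) - (z k - a k • f₁' (y k))‖ ^ 2 + f₂ (z (k + 1)) ≤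
          1 / (2 * a k) * ‖u - (z k - a k • f₁' (y k))‖ ^ 2 + f₂ u)
    (hxrec : ∀ k, x (k + 1) = (A k / (A k + a k)) • x k + (a k / (A k + a k)) • z (k + 1)) :
    ∀ k : ℕ,
      A (k + 1) * (g₁ (x (k + 1)) + g₂ (x (k + 1)) - (g₁ xstar + g₂ xstar)) -
          A k * (g₁ (x k) + g₂ (x k) - (g₁ xstar + g₂ xstar)) ≤
        a k * (gs k - (g₁ xstar + g₂ xstar)) +
          L_g * a k ^ 2 / (2 * A (k + 1)) * ‖z (k + 1) - z k‖ ^ 2 := by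
  intro k
  have hA (j : ℕ) : 0 ≤ A j := by
    induction j with
    | zero => exact hA0.ge
    | succ j ih => rw [hArec]; exact add_nonneg ih (ha j).le
  have hak := ha k
  have hAk := hA k
  have hS : 0 < A k + a k := by linarith
  have hp : 0 ≤ A k / (A k + a k) := by positivity
  have hq : 0 ≤ a k / (A k + a k) := by positivity
  have hpq : A k / (A k + a k) + a k / (A k + a k) = 1 := by field_simp
  have hlower := hg₁conv.add_inner_gradient_le (hg₁' (y k)) (x k)
  have hupper := le_add_inner_gradient_add_sq hg₁' hLipg (y k) (x (k + 1))
  have hconv := hg₂conv.2 (Set.mem_univ (x k)) (Set.mem_univ (z (k + 1))) hp hq hpq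
  rw [← hxrec k, smul_eq_mul, smul_eq_mul] at hconv
  have hstep : x (k + 1) - y k = (a k / (A k + a k)) • (z (k + 1) - z k) := by
    rw [hxrec k, hy k]
    module
  have hcomb : x (k + 1) - y k = (A k / (A k + a k)) • (x k - y k)
      + (a k / (A k + a k)) • (z (k + 1) - y k) := by
    rw [hxrec k, eq_sub_of_add_eq hpq]
    module
  have hnorm : ‖x (k + 1) - y k‖ ^ 2
      = (a k / (A k + a k)) ^ 2 * ‖z (k + 1) - z k‖ ^ 2 := by
    rw [hstep, norm_smul, mul_pow, Real.norm_of_nonneg hq]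
  rw [hnorm, hcomb, inner_add_right, real_inner_smul_right, real_inner_smul_right] at hupper
  have hmodel : g₁ (x (k + 1)) + g₂ (x (k + 1))
      ≤ A k / (A k + a k) * (g₁ (x k) + g₂ (x k)) + a k / (A k + a k) * gs k
        + L_g / 2 * ((a k / (A k + a k)) ^ 2 * ‖z (k + 1) - z k‖ ^ 2) := by
    have h₁ := mul_le_mul_of_nonneg_left hlower hp
    have h₂ := mul_le_mul_of_nonneg_left (hzmem k) hq
    linear_combination hupper + hconv + h₁ + h₂ - g₁ (y k) * hpq
  have hscaled := mul_le_mul_of_nonneg_left hmodel hS.le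
  have hexpand : (A k + a k) * (A k / (A k + a k) * (g₁ (x k) + g₂ (x k))
        + a k / (A k + a k) * gs k
        + L_g / 2 * ((a k / (A k + a k)) ^ 2 * ‖z (k + 1) - z k‖ ^ 2))
      = A k * (g₁ (x k) + g₂ (x k)) + a k * gs k
        + L_g * a k ^ 2 / (2 * (A k + a k)) * ‖z (k + 1) - z k‖ ^ 2 := by
    field_simp
  rw [hArec k]
  linarith
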